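/- Let X be a Polish, locally compact Hausdorff space, and let k : X × X → ℝ be a bounded continuous symmetric positive semidefinite kernel with 0 ≤ k(·,·) ≤ K for some K > 0, such that the MMD d_k is a metric on P(X) that metrizes the topology of weak convergence. Let P, Q be Borel probability measures on X, let x_1, x_2, … be i.i.d. with law Q, with empirical measures Q̂_n, and fix α ∈ (0,1). Set γ_n = sqrt(2K/n)·(1 + sqrt(log(1/α))). Then: (1) if Q = P, for every n, Prob(d_k(P, Q̂_n) > γ_n) ≤ α; and (2) if 0 < D(P‖Q) < ∞, then liminf_{n→∞} −(1/n) log Prob(d_k(P, Q̂_n) ≤ γ_n) = D(P‖Q). -/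

import Mathlib

open MeasureTheory Filter Topology ENNReal
open scoped Classical

noncomputable section
/-- The Kullback-Leibler divergence `D(P‖Q) ∈ [0,∞]`: it equals `∫ log (dP/dQ) dP` when
`P ≪ Q` (and the integral is well defined), and `+∞` otherwise. -/
def klDiv {X : Type*} [MeasurableSpace X] (P Q : Measure X) : ℝ≥0∞ :=
  if P ≪ Q ∧ Integrable (llr P Q) P then ENNReal.ofReal (∫ x, llr P Q x ∂P) else ⊤
/-- The empirical measure `(1/n) ∑_{i<n} δ_{x i}` of a sample, as a probability measure
(junk value for `n = 0`). -/
def empMeas {X : Type*} [MeasurableSpace X] [Nonempty X] (n : ℕ) (x : Fin n → X) :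
    ProbabilityMeasure X :=
  if h : 0 < n then
    ⟨(n : ℝ≥0∞)⁻¹ • ∑ i, Measure.dirac (x i), by
      constructor
      simp only [Measure.smul_apply, smul_eq_mul, Measure.coe_finset_sum, Finset.sum_apply,
        measure_univ, Finset.sum_const, Finset.card_univ, Fintype.card_fin, nsmul_eq_mul, mul_one]
      exact ENNReal.inv_mul_cancel (by exact_mod_cast h.ne') (by simp)⟩
  else ⟨Measure.dirac (Classical.arbitrary X), inferInstance⟩
/-- The squared Maximum Mean Discrepancy associated with the kernel `k`. -/
def mmdSq {X : Type*} [MeasurableSpace X] (k : X → X → ℝ) (P Q : Measure X) : ℝ :=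
  (∫ y, ∫ y', k y y' ∂P ∂P) + (∫ x, ∫ x', k x x' ∂Q ∂Q) - 2 * ∫ y, ∫ x, k y x ∂Q ∂P

/-- The Maximum Mean Discrepancy `d_k`, the nonnegative square root of `mmdSq`. -/
def mmd {X : Type*} [MeasurableSpace X] (k : X → X → ℝ) (P Q : Measure X) : ℝ :=
  Real.sqrt (mmdSq k P Q)
/-- The exponential decay rate `-(1/n) log p` of a probability `p`, valued in `EReal`
(with `-(1/n) log 0 = ⊤`). -/
def expRate (n : ℕ) (p : ℝ≥0∞) : EReal := -((((n : ℝ)⁻¹ : ℝ) : EReal) * ENNReal.log p)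

open ProbabilityTheory in
/-- Hoeffding's lemma in terms of the oscillation of a bounded function. -/
lemma integral_exp_sub_integral_le_of_osc_le {Y : Type*} [MeasurableSpace Y] (μ : Measure Y)
    [IsProbabilityMeasure μ] {f : Y → ℝ} (hf : Measurable f) {c : ℝ} (hc : 0 ≤ c)
    (hosc : ∀ a b, f a ≤ f b + c) (t : ℝ) :
    ∫ a, Real.exp (t * (f a - ∫ b, f b ∂μ)) ∂μ ≤ Real.exp (c ^ 2 / 4 * t ^ 2 / 2) := by
  obtain ⟨a₀⟩ : Nonempty Y := nonempty_of_isProbabilityMeasure μ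
  have hbdd : BddBelow (Set.range f) := by
    refine ⟨f a₀ - c, ?_⟩
    rintro _ ⟨a, rfl⟩
    linarith [hosc a₀ a]
  have hmem : ∀ a, f a ∈ Set.Icc (⨅ b, f b) ((⨅ b, f b) + c) := by
    intro a
    refine ⟨ciInf_le hbdd a, ?_⟩
    have : Nonempty Y := ⟨a⟩
    have : f a - c ≤ ⨅ b, f b := le_ciInf fun b => by linarith [hosc a b]
    linarith
  have h := (hasSubgaussianMGF_of_mem_Icc (μ := μ) hf.aemeasurable
    (Eventually.of_forall hmem)).mgf_le t
  have hn : (((‖(⨅ b, f b) + c - ⨅ b, f b‖₊ / 2) ^ 2 : NNReal) : ℝ) = c ^ 2 / 4 := by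
    simp [abs_of_nonneg hc, div_pow]
    norm_num
  rw [hn] at h
  exact h

lemma integrable_of_abs_le {Y : Type*} [MeasurableSpace Y] (μ : Measure Y)
    [IsFiniteMeasure μ] {f : Y → ℝ} (hf : Measurable f) {B : ℝ} (hB : ∀ x, |f x| ≤ B) :
    Integrable f μ :=
  Integrable.of_bound hf.aestronglyMeasurable B (Eventually.of_forall hB)

lemma integrable_exp_mul_sub_of_abs_le {Y : Type*} [MeasurableSpace Y] (μ : Measure Y)
    [IsFiniteMeasure μ] {f : Y → ℝ} (hf : Measurable f) {B : ℝ} (hB : ∀ x, |f x| ≤ B)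
    (t m : ℝ) : Integrable (fun x => Real.exp (t * (f x - m))) μ := by
  refine integrable_of_abs_le μ (by fun_prop) (B := Real.exp (|t| * (B + |m|))) fun x => ?_
  rw [abs_of_pos (Real.exp_pos _)]
  refine Real.exp_le_exp.2 ?_
  calc t * (f x - m) ≤ |t * (f x - m)| := le_abs_self _
    _ = |t| * |f x - m| := abs_mul _ _
    _ ≤ |t| * (B + |m|) := by
      gcongr
      exact (abs_sub _ _).trans (by linarith [hB x])

/-- The moment generating function bound behind McDiarmid's inequality. -/
lemma integral_exp_le_of_boundedDifferences {Y : Type*} [MeasurableSpace Y] (μ : Measure Y)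
    [IsProbabilityMeasure μ] {c : ℝ} (hc : 0 ≤ c) {B : ℝ} (t : ℝ) (n : ℕ) (f : (Fin n → Y) → ℝ)
    (hf : Measurable f) (hB : ∀ x, |f x| ≤ B)
    (hdiff : ∀ x i a, f (Function.update x i a) ≤ f x + c) :
    ∫ x, Real.exp (t * (f x - ∫ y, f y ∂Measure.pi fun _ => μ)) ∂Measure.pi (fun _ => μ)
      ≤ Real.exp (n * (c ^ 2 / 4) * t ^ 2 / 2) := by
  induction n with
  | zero =>
    have hx : ∀ x : Fin 0 → Y, f x = f default := fun x => by rw [Subsingleton.elim x default]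
    simp [hx]
  | succ n ih =>
    have hmp := (measurePreserving_piFinSuccAbove (fun _ : Fin (n + 1) => μ) 0).symm
    have hcons : Measurable fun p : Y × (Fin n → Y) => (Fin.cons p.1 p.2 : Fin (n + 1) → Y) := by
      have := hmp.measurable
      simpa [MeasurableEquiv.piFinSuccAbove_symm_apply, Fin.insertNthEquiv] using this
    have hint : ∀ g : (Fin (n + 1) → Y) → ℝ, ∀ C : ℝ, Measurable g → (∀ x, |g x| ≤ C) →
        ∫ x, g x ∂Measure.pi (fun _ => μ)
          = ∫ y, ∫ a, g (Fin.cons a y) ∂μ ∂Measure.pi (fun _ => μ) := by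
      intro g C hg hC
      rw [← hmp.integral_comp']
      simp only [MeasurableEquiv.piFinSuccAbove_symm_apply, Fin.insertNthEquiv,
        Fin.insertNth_zero, Equiv.coe_fn_mk]
      exact integral_prod_symm _ (integrable_of_abs_le _ (hg.comp hcons) fun p => hC _)
    set g : (Fin n → Y) → ℝ := fun y => ∫ a, f (Fin.cons a y) ∂μ with hg_def
    have hfy : ∀ y : Fin n → Y, Measurable fun a => f (Fin.cons a y) := fun y =>
      hf.comp (hcons.comp (measurable_id.prodMk measurable_const))
    have hfi : ∀ y : Fin n → Y, Integrable (fun a => f (Fin.cons a y)) μ := fun y =>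
      integrable_of_abs_le μ (hfy y) fun a => hB _
    have hg : Measurable g := by
      have h2 : Measurable fun p : (Fin n → Y) × Y => f (Fin.cons p.2 p.1) :=
        (hf.comp hcons).comp measurable_swap
      exact h2.stronglyMeasurable.integral_prod_right.measurable
    have hgB : ∀ y, |g y| ≤ B := fun y => by
      have := norm_integral_le_of_norm_le_const (μ := μ) (f := fun a => f (Fin.cons a y)) (C := B)
        (Eventually.of_forall fun a => hB _)
      simpa using this
    have hgdiff : ∀ x i a, g (Function.update x i a) ≤ g x + c := by
      intro x i a
      have : g x + c = ∫ b, (f (Fin.cons b x) + c) ∂μ := by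
        rw [integral_add (hfi x) (integrable_const c)]
        simp [hg_def]
      rw [this]
      refine integral_mono (hfi _) ((hfi x).add (integrable_const c)) fun b => ?_
      have := hdiff (Fin.cons b x) i.succ a
      rwa [← Fin.cons_update] at this
    have hm : ∫ y, f y ∂Measure.pi (fun _ => μ) = ∫ y, g y ∂Measure.pi (fun _ => μ) :=
      hint f B hf hB
    rw [hm]
    set m := ∫ y, g y ∂Measure.pi (fun _ => μ) with hm_def
    have hE : ∀ x, |Real.exp (t * (f x - m))| ≤ Real.exp (|t| * (B + |m|)) := by
      intro x
      rw [abs_of_pos (Real.exp_pos _)]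
      refine Real.exp_le_exp.2 ?_
      calc t * (f x - m) ≤ |t * (f x - m)| := le_abs_self _
        _ = |t| * |f x - m| := abs_mul _ _
        _ ≤ |t| * (B + |m|) := by
          gcongr
          exact (abs_sub _ _).trans (by linarith [hB x])
    rw [hint (fun x => Real.exp (t * (f x - m))) _ (by fun_prop) hE]
    have hinner : ∀ y, ∫ a, Real.exp (t * (f (Fin.cons a y) - m)) ∂μ
        ≤ Real.exp (t * (g y - m)) * Real.exp (c ^ 2 / 4 * t ^ 2 / 2) := by
      intro y
      have h1 : ∀ a, Real.exp (t * (f (Fin.cons a y) - m))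
          = Real.exp (t * (g y - m)) * Real.exp (t * (f (Fin.cons a y) - g y)) := by
        intro a
        rw [← Real.exp_add]
        ring_nf
      simp_rw [h1]
      rw [integral_const_mul]
      gcongr
      refine integral_exp_sub_integral_le_of_osc_le μ (hfy y) hc (fun a b => ?_) t
      have := hdiff (Fin.cons b y) 0 a
      rwa [Fin.update_cons_zero] at this
    calc _ ≤ ∫ y, Real.exp (t * (g y - m)) * Real.exp (c ^ 2 / 4 * t ^ 2 / 2)
          ∂Measure.pi (fun _ => μ) := by
          refine integral_mono ?_
            ((integrable_exp_mul_sub_of_abs_le _ hg hgB t m).mul_const _) hinner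
          refine integrable_of_abs_le _ (B := Real.exp (|t| * (B + |m|))) ?_ fun y => ?_
          · have h2 : Measurable fun p : (Fin n → Y) × Y =>
                Real.exp (t * (f (Fin.cons p.2 p.1) - m)) :=
              Measurable.exp (((hf.comp (hcons.comp measurable_swap)).sub_const m).const_mul t)
            exact h2.stronglyMeasurable.integral_prod_right.measurable
          · have := norm_integral_le_of_norm_le_const (μ := μ)
              (f := fun a => Real.exp (t * (f (Fin.cons a y) - m)))
              (C := Real.exp (|t| * (B + |m|))) (Eventually.of_forall fun a => hE _)
            simpa only [Real.norm_eq_abs, probReal_univ, mul_one] using this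
      _ ≤ Real.exp (n * (c ^ 2 / 4) * t ^ 2 / 2) * Real.exp (c ^ 2 / 4 * t ^ 2 / 2) := by
          rw [integral_mul_const]
          gcongr
          exact ih g hg hgB hgdiff
      _ = _ := by
          rw [← Real.exp_add]
          push_cast
          ring_nf

open ProbabilityTheory in
/-- McDiarmid's bounded differences inequality. -/
lemma measureReal_le_of_boundedDifferences {Y : Type*} [MeasurableSpace Y] (μ : Measure Y)
    [IsProbabilityMeasure μ] {c : ℝ} (hc : 0 ≤ c) {B : ℝ} (n : ℕ) (f : (Fin n → Y) → ℝ)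
    (hf : Measurable f) (hB : ∀ x, |f x| ≤ B)
    (hdiff : ∀ x i a, f (Function.update x i a) ≤ f x + c) {s : ℝ} (hs : 0 ≤ s) :
    (Measure.pi fun _ => μ).real {x | s ≤ f x - ∫ y, f y ∂Measure.pi fun _ => μ}
      ≤ Real.exp (-s ^ 2 / (2 * (n * (c ^ 2 / 4)))) := by
  have h : HasSubgaussianMGF (fun x => f x - ∫ y, f y ∂Measure.pi fun _ => μ)
      ⟨n * (c ^ 2 / 4), by positivity⟩ (Measure.pi fun _ => μ) :=
    ⟨fun t => integrable_exp_mul_sub_of_abs_le _ hf hB t _,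
      fun t => integral_exp_le_of_boundedDifferences μ hc t n f hf hB hdiff⟩
  exact h.measure_ge_le hs

lemma coe_empMeas {X : Type*} [MeasurableSpace X] [Nonempty X] {n : ℕ} (hn : 0 < n)
    (x : Fin n → X) :
    (empMeas n x : Measure X) = (n : ℝ≥0∞)⁻¹ • ∑ i, Measure.dirac (x i) := by
  simp [empMeas, hn]

lemma integral_empMeas {X : Type*} [MeasurableSpace X] [Nonempty X] {n : ℕ} (hn : 0 < n)
    (x : Fin n → X) {f : X → ℝ} (hf : Measurable f) :
    ∫ a, f a ∂(empMeas n x : Measure X) = (n : ℝ)⁻¹ * ∑ i, f (x i) := by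
  rw [coe_empMeas hn, integral_smul_measure, integral_finsetSum_measure]
  · simp [integral_dirac' _ _ hf.stronglyMeasurable]
  · intro i _
    exact integrable_dirac' hf.stronglyMeasurable (by simp)

section Mmd

variable {X : Type*} [MeasurableSpace X] {k : X → X → ℝ} {K : ℝ}

lemma mmdSq_self (P : Measure X) : mmdSq k P P = 0 := by
  unfold mmdSq
  ring

lemma mmdSq_comm (hk : Measurable (Function.uncurry k)) (hk_symm : ∀ x y, k x y = k y x)
    (hk_bdd : ∀ x y, k x y ∈ Set.Icc (0 : ℝ) K) (P Q : Measure X)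
    [IsProbabilityMeasure P] [IsProbabilityMeasure Q] : mmdSq k P Q = mmdSq k Q P := by
  have h : ∫ y, ∫ x, k y x ∂Q ∂P = ∫ y, ∫ x, k y x ∂P ∂Q := by
    rw [integral_integral_swap]
    · simp_rw [fun y x => hk_symm y x]
    · refine integrable_of_abs_le _ hk (B := K) fun p => ?_
      rw [Function.uncurry, abs_of_nonneg (hk_bdd _ _).1]
      exact (hk_bdd _ _).2
  unfold mmdSq
  rw [h]
  ring

lemma mmd_comm (hk : Measurable (Function.uncurry k)) (hk_symm : ∀ x y, k x y = k y x)
    (hk_bdd : ∀ x y, k x y ∈ Set.Icc (0 : ℝ) K) (P Q : Measure X)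
    [IsProbabilityMeasure P] [IsProbabilityMeasure Q] : mmd k P Q = mmd k Q P := by
  rw [mmd, mmd, mmdSq_comm hk hk_symm hk_bdd]

lemma mmdSq_nonneg (h_sep : ∀ R S : ProbabilityMeasure X,
      mmd k (R : Measure X) (S : Measure X) = 0 ↔ R = S) (R S : ProbabilityMeasure X) :
    0 ≤ mmdSq k (R : Measure X) (S : Measure X) := by
  by_contra! h
  have hRS : R = S := (h_sep R S).1 (Real.sqrt_eq_zero_of_nonpos h.le)
  rw [hRS, mmdSq_self] at h
  exact lt_irrefl _ h

lemma mmdSq_empMeas_right [Nonempty X] (hk : Measurable (Function.uncurry k))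
    (hk_bdd : ∀ x y, k x y ∈ Set.Icc (0 : ℝ) K) (P : Measure X) [IsProbabilityMeasure P]
    {n : ℕ} (hn : 0 < n) (x : Fin n → X) :
    mmdSq k P (empMeas n x : Measure X)
      = (∫ y, ∫ y', k y y' ∂P ∂P) + (n : ℝ)⁻¹ * ∑ i, (n : ℝ)⁻¹ * ∑ j, k (x i) (x j)
        - 2 * ((n : ℝ)⁻¹ * ∑ i, ∫ y, k y (x i) ∂P) := by
  have h1 : ∀ a, Measurable (k a) := fun a => hk.comp measurable_prodMk_left
  have h2 : ∀ a, Measurable fun y => k y a := fun a => hk.comp measurable_prodMk_right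
  unfold mmdSq
  simp_rw [fun a => integral_empMeas hn x (h1 a)]
  rw [integral_empMeas hn x, integral_const_mul, integral_finsetSum]
  · intro i _
    refine integrable_of_abs_le _ (h2 _) (B := K) fun y => ?_
    rw [abs_of_nonneg (hk_bdd _ _).1]
    exact (hk_bdd _ _).2
  · exact (Finset.measurable_sum _ fun i _ => h2 _).const_mul _

lemma measurable_mmdSq_empMeas [Nonempty X] (hk : Measurable (Function.uncurry k))
    (hk_bdd : ∀ x y, k x y ∈ Set.Icc (0 : ℝ) K) (P : Measure X) [IsProbabilityMeasure P]
    {n : ℕ} (hn : 0 < n) :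
    Measurable fun x : Fin n → X => mmdSq k P (empMeas n x : Measure X) := by
  simp_rw [mmdSq_empMeas_right hk hk_bdd P hn]
  have h1 : ∀ i j : Fin n, Measurable fun x : Fin n → X => k (x i) (x j) := fun i j =>
    hk.comp (f := fun x : Fin n → X => (x i, x j))
      ((measurable_pi_apply i).prodMk (measurable_pi_apply j))
  have h2 : Measurable fun a => ∫ y, k y a ∂P :=
    hk.stronglyMeasurable.integral_prod_left.measurable
  have h3 : ∀ i : Fin n, Measurable fun x : Fin n → X => ∫ y, k y (x i) ∂P := fun i =>
    h2.comp (measurable_pi_apply i)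
  fun_prop

lemma mmdSq_le (hk_bdd : ∀ x y, k x y ∈ Set.Icc (0 : ℝ) K)
    (P Q : Measure X) [IsProbabilityMeasure P] [IsProbabilityMeasure Q] :
    mmdSq k P Q ≤ 2 * K := by
  have hup : ∀ μ ν : Measure X, IsProbabilityMeasure μ → IsProbabilityMeasure ν →
      ‖∫ y, ∫ x, k y x ∂ν ∂μ‖ ≤ K := by
    intro μ ν _ _
    have h1 : ∀ y, ‖∫ x, k y x ∂ν‖ ≤ K := fun y => by
      have := norm_integral_le_of_norm_le_const (μ := ν) (f := k y) (C := K)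
        (Eventually.of_forall fun x => by
          rw [Real.norm_eq_abs, abs_of_nonneg (hk_bdd _ _).1]
          exact (hk_bdd _ _).2)
      simpa using this
    have := norm_integral_le_of_norm_le_const (μ := μ) (f := fun y => ∫ x, k y x ∂ν) (C := K)
      (Eventually.of_forall h1)
    simpa using this
  have h0 : 0 ≤ ∫ y, ∫ x, k y x ∂Q ∂P :=
    integral_nonneg fun y => integral_nonneg fun x => (hk_bdd y x).1
  have h1 := (le_abs_self _).trans (hup P P ‹_› ‹_›)
  have h2 := (le_abs_self _).trans (hup Q Q ‹_› ‹_›)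
  unfold mmdSq
  linarith

lemma mmdSq_empMeas_update_le [Nonempty X] (hk : Measurable (Function.uncurry k))
    (hk_symm : ∀ x y, k x y = k y x)
    (hk_bdd : ∀ x y, k x y ∈ Set.Icc (0 : ℝ) K) {n : ℕ} (hn : 0 < n) (x : Fin n → X)
    (i : Fin n) (a : X) :
    mmdSq k (empMeas n x : Measure X) (empMeas n (Function.update x i a) : Measure X)
      ≤ 2 * K / n ^ 2 := by
  set y := Function.update x i a with hy
  have hne : ∀ j, j ≠ i → y j = x j := fun j hj => by simp [hy, hj]
  have h1 : ∀ a, Measurable (k a) := fun a => hk.comp measurable_prodMk_left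
  have h2 : ∀ a, Measurable fun y => k y a := fun a => hk.comp measurable_prodMk_right
  have hsum : mmdSq k (empMeas n x : Measure X) (empMeas n y : Measure X)
      = (n : ℝ)⁻¹ * ((n : ℝ)⁻¹ * ∑ p, ∑ q,
        (k (x p) (x q) + k (y p) (y q) - k (x p) (y q) - k (y p) (x q))) := by
    have h3 : ∀ z : Fin n → X, Measurable fun a => (n : ℝ)⁻¹ * ∑ j, k a (z j) := fun z =>
      (Finset.measurable_sum _ fun j _ => h2 _).const_mul _
    have h4 : ∑ p, ∑ q, k (y p) (x q) = ∑ p, ∑ q, k (x p) (y q) := by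
      rw [Finset.sum_comm]
      simp_rw [fun p q => hk_symm (y p) (x q)]
    unfold mmdSq
    simp_rw [fun a => integral_empMeas hn x (h1 a), fun a => integral_empMeas hn y (h1 a),
      integral_empMeas hn x (h3 x), integral_empMeas hn x (h3 y), integral_empMeas hn y (h3 y),
      Finset.sum_sub_distrib, Finset.sum_add_distrib, h4, ← Finset.mul_sum]
    ring
  have hdiag : ∑ p, ∑ q, (k (x p) (x q) + k (y p) (y q) - k (x p) (y q) - k (y p) (x q))
      = k (x i) (x i) + k (y i) (y i) - k (x i) (y i) - k (y i) (x i) := by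
    rw [Finset.sum_eq_single i, Finset.sum_eq_single i]
    · intro q _ hq
      rw [hne q hq]
      ring
    · simp
    · intro p _ hp
      refine Finset.sum_eq_zero fun q _ => ?_
      rw [hne p hp]
      ring
    · simp
  have hle : k (x i) (x i) + k (y i) (y i) - k (x i) (y i) - k (y i) (x i) ≤ 2 * K := by
    linarith [(hk_bdd (x i) (x i)).2, (hk_bdd (y i) (y i)).2, (hk_bdd (x i) (y i)).1,
      (hk_bdd (y i) (x i)).1]
  rw [hsum, hdiag]
  have hn' : (0 : ℝ) < n := by exact_mod_cast hn
  rw [le_div_iff₀ (by positivity)]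
  field_simp
  exact hle

open ProbabilityTheory in
lemma integral_pi_eval_pair (hk : Measurable (Function.uncurry k))
    (hk_bdd : ∀ x y, k x y ∈ Set.Icc (0 : ℝ) K) (P : Measure X) [IsProbabilityMeasure P] {n : ℕ}
    {i j : Fin n} (hij : i ≠ j) :
    ∫ x : Fin n → X, k (x i) (x j) ∂Measure.pi (fun _ => P) = ∫ y, ∫ y', k y y' ∂P ∂P := by
  have hind : iIndepFun (fun (i : Fin n) (x : Fin n → X) => x i) (Measure.pi fun _ => P) :=
    iIndepFun_pi (X := fun _ => id) fun _ => aemeasurable_id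
  have hmap := (indepFun_iff_map_prod_eq_prod_map_map (measurable_pi_apply i).aemeasurable
    (measurable_pi_apply j).aemeasurable).1 (hind.indepFun hij)
  have he : ∀ i : Fin n, (Measure.pi fun _ : Fin n => P).map (fun x => x i) = P := fun i =>
    (measurePreserving_eval (fun _ : Fin n => P) i).map_eq
  rw [he, he] at hmap
  have hm : Measurable fun x : Fin n → X => (x i, x j) :=
    (measurable_pi_apply i).prodMk (measurable_pi_apply j)
  have h1 : ∫ x : Fin n → X, k (x i) (x j) ∂Measure.pi (fun _ => P)
      = ∫ z, Function.uncurry k z ∂(P.prod P) := by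
    rw [← hmap, integral_map hm.aemeasurable hk.aestronglyMeasurable]
    rfl
  rw [h1, integral_prod]
  · rfl
  · refine integrable_of_abs_le _ hk (B := K) fun p => ?_
    rw [Function.uncurry, abs_of_nonneg (hk_bdd _ _).1]
    exact (hk_bdd _ _).2

lemma integral_pi_eval (P : Measure X) [IsProbabilityMeasure P] {n : ℕ} (i : Fin n) {f : X → ℝ}
    (hf : Measurable f) :
    ∫ x : Fin n → X, f (x i) ∂Measure.pi (fun _ => P) = ∫ y, f y ∂P := by
  have he := measurePreserving_eval (fun _ : Fin n => P) i
  conv_rhs => rw [← he.map_eq]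
  rw [integral_map he.aemeasurable hf.aestronglyMeasurable]

lemma integral_mmdSq_empMeas_le [Nonempty X] (hk : Measurable (Function.uncurry k))
    (hk_symm : ∀ x y, k x y = k y x) (hk_bdd : ∀ x y, k x y ∈ Set.Icc (0 : ℝ) K)
    (P : Measure X) [IsProbabilityMeasure P] {n : ℕ} (hn : 0 < n) :
    ∫ x : Fin n → X, mmdSq k P (empMeas n x : Measure X) ∂Measure.pi (fun _ => P) ≤ K / n := by
  simp_rw [mmdSq_empMeas_right hk hk_bdd P hn]
  set M := ∫ y, ∫ y', k y y' ∂P ∂P with hM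
  have hM0 : 0 ≤ M := integral_nonneg fun y => integral_nonneg fun x => (hk_bdd y x).1
  have hn' : (0 : ℝ) < n := by exact_mod_cast hn
  have hkm : ∀ i j : Fin n, Measurable fun x : Fin n → X => k (x i) (x j) := fun i j =>
    hk.comp (f := fun x : Fin n → X => (x i, x j))
      ((measurable_pi_apply i).prodMk (measurable_pi_apply j))
  have hki : ∀ i j : Fin n, Integrable (fun x : Fin n → X => k (x i) (x j))
      (Measure.pi fun _ => P) := fun i j => by
    refine integrable_of_abs_le _ (hkm i j) (B := K) fun p => ?_
    rw [abs_of_nonneg (hk_bdd _ _).1]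
    exact (hk_bdd _ _).2
  have hhm : Measurable fun a => ∫ y, k y a ∂P :=
    hk.stronglyMeasurable.integral_prod_left.measurable
  have hhi : ∀ i : Fin n, Integrable (fun x : Fin n → X => ∫ y, k y (x i) ∂P)
      (Measure.pi fun _ => P) := fun i => by
    refine integrable_of_abs_le _ (hhm.comp (measurable_pi_apply i)) (B := K) fun x => ?_
    have := norm_integral_le_of_norm_le_const (μ := P) (f := fun y => k y (x i)) (C := K)
        (Eventually.of_forall fun y => by
          rw [Real.norm_eq_abs, abs_of_nonneg (hk_bdd _ _).1]
          exact (hk_bdd _ _).2)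
    simpa using this
  have hhM : ∀ i : Fin n, ∫ x : Fin n → X, ∫ y, k y (x i) ∂P ∂Measure.pi (fun _ => P) = M := by
    intro i
    rw [integral_pi_eval P i hhm, hM]
    simp_rw [fun y x => hk_symm y x]
  have hkle : ∀ i j : Fin n, ∫ x : Fin n → X, k (x i) (x j) ∂Measure.pi (fun _ => P)
      ≤ (if i = j then K else 0) + M := by
    intro i j
    split_ifs with hij
    · have := integral_mono (hki i j) (integrable_const K) fun x => (hk_bdd (x i) (x j)).2
      simp only [integral_const, probReal_univ, one_smul] at this
      linarith
    · rw [integral_pi_eval_pair hk hk_bdd P hij, zero_add]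
  have hI1 : Integrable (fun x : Fin n → X => (n : ℝ)⁻¹ * ∑ i, (n : ℝ)⁻¹ * ∑ j, k (x i) (x j))
      (Measure.pi fun _ => P) :=
    (integrable_finsetSum _ fun i _ =>
      (integrable_finsetSum _ fun j _ => hki i j).const_mul _).const_mul _
  have hI2 : Integrable (fun x : Fin n → X => 2 * ((n : ℝ)⁻¹ * ∑ i, ∫ y, k y (x i) ∂P))
      (Measure.pi fun _ => P) :=
    ((integrable_finsetSum _ fun i _ => hhi i).const_mul _).const_mul _
  have hS : ∫ x : Fin n → X, ∑ i, (n : ℝ)⁻¹ * ∑ j, k (x i) (x j) ∂Measure.pi (fun _ => P)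
      ≤ K + n * M := by
    rw [integral_finsetSum _ fun i _ => (integrable_finsetSum _ fun j _ => hki i j).const_mul _]
    calc _ ≤ ∑ i : Fin n, (n : ℝ)⁻¹ * (K + n * M) := by
          refine Finset.sum_le_sum fun i _ => ?_
          rw [integral_const_mul, integral_finsetSum _ fun j _ => hki i j]
          gcongr
          calc _ ≤ ∑ j : Fin n, ((if i = j then K else 0) + M) :=
                Finset.sum_le_sum fun j _ => hkle i j
            _ = _ := by simp [Finset.sum_add_distrib]
      _ = _ := by
          simp
          field_simp
  have hI0 : Integrable
      (fun x : Fin n → X => M + (n : ℝ)⁻¹ * ∑ i, (n : ℝ)⁻¹ * ∑ j, k (x i) (x j))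
      (Measure.pi fun _ => P) := (integrable_const M).add hI1
  rw [integral_sub hI0 hI2, integral_add (integrable_const _) hI1,
    integral_const_mul, integral_const_mul, integral_const_mul,
    integral_finsetSum _ fun i _ => hhi i]
  simp_rw [hhM]
  simp only [integral_const, probReal_univ, one_smul, Finset.sum_const, Finset.card_univ,
    Fintype.card_fin, nsmul_eq_mul]
  have h5 := mul_le_mul_of_nonneg_left hS (inv_nonneg.2 hn'.le)
  have h6 : (n : ℝ)⁻¹ * (K + n * M) = K / n + M := by field_simp
  have h7 : (n : ℝ)⁻¹ * (n * M) = M := by field_simp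
  linarith

open ProbabilityTheory in
lemma sq_integral_le_integral_sq {Y : Type*} [MeasurableSpace Y] (μ : Measure Y)
    [IsProbabilityMeasure μ] {f : Y → ℝ} (hf : MemLp f 2 μ) :
    (∫ x, f x ∂μ) ^ 2 ≤ ∫ x, f x ^ 2 ∂μ := by
  have h := variance_nonneg f μ
  rw [variance_eq_sub hf] at h
  simpa using h

/-- The type-I error bound of the MMD test. -/
lemma measure_lt_mmd_empMeas_le [Nonempty X] (hk : Measurable (Function.uncurry k))
    (hk_symm : ∀ x y, k x y = k y x) (hK : 0 < K) (hk_bdd : ∀ x y, k x y ∈ Set.Icc (0 : ℝ) K)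
    (h_sep : ∀ R S : ProbabilityMeasure X,
      mmd k (R : Measure X) (S : Measure X) = 0 ↔ R = S)
    (h_tri : ∀ R S T : ProbabilityMeasure X,
      mmd k (R : Measure X) (T : Measure X)
        ≤ mmd k (R : Measure X) (S : Measure X) + mmd k (S : Measure X) (T : Measure X))
    (P : ProbabilityMeasure X) {α : ℝ} (hα0 : 0 < α) (hα1 : α < 1) {n : ℕ} (hn : 0 < n) :
    Measure.pi (fun _ : Fin n => (P : Measure X))
        {x | Real.sqrt (2 * K / n) * (1 + Real.sqrt (Real.log (1 / α)))
          < mmd k (P : Measure X) (empMeas n x : Measure X)}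
      ≤ ENNReal.ofReal α := by
  have hn' : (0 : ℝ) < n := by exact_mod_cast hn
  set f : (Fin n → X) → ℝ := fun x => mmd k (P : Measure X) (empMeas n x : Measure X) with hf_def
  have hf : Measurable f := (measurable_mmdSq_empMeas hk hk_bdd _ hn).sqrt
  have hB : ∀ x, |f x| ≤ Real.sqrt (2 * K) := fun x => by
    rw [abs_of_nonneg (show 0 ≤ f x from Real.sqrt_nonneg _)]
    exact Real.sqrt_le_sqrt (mmdSq_le hk_bdd _ _)
  have hdiff : ∀ x i a, f (Function.update x i a) ≤ f x + Real.sqrt (2 * K) / n := by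
    intro x i a
    refine (h_tri P (empMeas n x) (empMeas n (Function.update x i a))).trans ?_
    gcongr
    refine (Real.sqrt_le_sqrt (mmdSq_empMeas_update_le hk hk_symm hk_bdd hn x i a)).trans ?_
    rw [Real.sqrt_div (by positivity), Real.sqrt_sq hn'.le]
  have hEf : ∫ x, f x ∂Measure.pi (fun _ => (P : Measure X)) ≤ Real.sqrt (2 * K / n) := by
    refine Real.le_sqrt_of_sq_le ?_
    refine (sq_integral_le_integral_sq _ (MemLp.of_bound hf.aestronglyMeasurable _
      (Eventually.of_forall hB))).trans ?_
    have hsq : ∀ x, f x ^ 2 = mmdSq k (P : Measure X) (empMeas n x : Measure X) := fun x =>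
      Real.sq_sqrt (mmdSq_nonneg h_sep _ _)
    simp_rw [hsq]
    refine (integral_mmdSq_empMeas_le hk hk_symm hk_bdd _ hn).trans ?_
    gcongr
    linarith
  set L := Real.log (1 / α) with hL
  have hL0 : 0 ≤ L := Real.log_nonneg (by rw [le_div_iff₀ hα0]; linarith)
  have hmc := measureReal_le_of_boundedDifferences (P : Measure X)
    (c := Real.sqrt (2 * K) / n) (by positivity) n f hf hB hdiff
    (s := Real.sqrt (2 * K / n) * Real.sqrt L) (by positivity)
  have hexp : Real.exp (-(Real.sqrt (2 * K / n) * Real.sqrt L) ^ 2 /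
      (2 * (n * ((Real.sqrt (2 * K) / n) ^ 2 / 4)))) ≤ α := by
    have h1 : -(Real.sqrt (2 * K / n) * Real.sqrt L) ^ 2 /
      (2 * (n * ((Real.sqrt (2 * K) / n) ^ 2 / 4))) = -(2 * L) := by
      rw [mul_pow, div_pow, Real.sq_sqrt (by positivity), Real.sq_sqrt hL0,
        Real.sq_sqrt (by positivity)]
      field_simp
      ring
    rw [h1]
    calc Real.exp (-(2 * L)) ≤ Real.exp (-L) := Real.exp_le_exp.2 (by linarith)
      _ = α := by rw [hL, one_div, Real.log_inv, neg_neg, Real.exp_log hα0]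
  refine (measure_mono fun x hx => ?_).trans
    ((ENNReal.le_ofReal_iff_toReal_le (measure_ne_top _ _) hα0.le).2 (hmc.trans hexp))
  simp only [Set.mem_ofPred_eq] at hx ⊢
  change _ < f x at hx
  linarith

end Mmd

lemma le_expRate {n : ℕ} (hn : 0 < n) {p : ℝ≥0∞} {c : ℝ}
    (h : p ≤ ENNReal.ofReal (Real.exp (-(n * c)))) : (c : EReal) ≤ expRate n p := by
  have hn' : (0 : ℝ) < n := by exact_mod_cast hn
  have h1 := ENNReal.log_le_log h
  rw [ENNReal.log_ofReal_of_pos (Real.exp_pos _), Real.log_exp] at h1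
  have h2 := mul_le_mul_of_nonneg_left h1
    (show (0 : EReal) ≤ (((n : ℝ)⁻¹ : ℝ) : EReal) by exact_mod_cast (inv_nonneg.2 hn'.le))
  rw [← EReal.coe_mul, show (n : ℝ)⁻¹ * -(n * c) = -c by field_simp, EReal.coe_neg] at h2
  unfold expRate
  exact EReal.le_neg_of_le_neg h2

lemma expRate_le {n : ℕ} (hn : 0 < n) {p : ℝ≥0∞} {c : ℝ}
    (h : ENNReal.ofReal (Real.exp (-(n * c))) ≤ p) : expRate n p ≤ (c : EReal) := by
  have hn' : (0 : ℝ) < n := by exact_mod_cast hn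
  have h1 := ENNReal.log_le_log h
  rw [ENNReal.log_ofReal_of_pos (Real.exp_pos _), Real.log_exp] at h1
  have h2 := mul_le_mul_of_nonneg_left h1
    (show (0 : EReal) ≤ (((n : ℝ)⁻¹ : ℝ) : EReal) by exact_mod_cast (inv_nonneg.2 hn'.le))
  rw [← EReal.coe_mul, show (n : ℝ)⁻¹ * -(n * c) = -c by field_simp, EReal.coe_neg] at h2
  unfold expRate
  exact EReal.neg_le_of_neg_le h2

section Product

variable {X : Type*} [MeasurableSpace X]

open ProbabilityTheory in
lemma lintegral_pi_prod (μ : Measure X) [IsProbabilityMeasure μ] {n : ℕ}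
    {f : Fin n → X → ℝ≥0∞} (hf : ∀ i, Measurable (f i)) :
    ∫⁻ x, ∏ i, f i (x i) ∂Measure.pi (fun _ => μ) = ∏ i, ∫⁻ a, f i a ∂μ := by
  have hind : iIndepFun (fun (i : Fin n) (x : Fin n → X) => f i (x i))
      (Measure.pi fun _ => μ) := iIndepFun_pi fun i => (hf i).aemeasurable
  rw [lintegral_prod_eq_prod_lintegral_of_indepFun _ _ hind
    fun i => (hf i).comp (measurable_pi_apply i)]
  refine Finset.prod_congr rfl fun i _ => ?_
  exact (measurePreserving_eval (fun _ : Fin n => μ) i).lintegral_comp (hf i)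

lemma pi_eq_withDensity_prod_rnDeriv (P Q : Measure X) [IsProbabilityMeasure P]
    [IsProbabilityMeasure Q] (hPQ : P ≪ Q) (n : ℕ) :
    Measure.pi (fun _ : Fin n => P)
      = (Measure.pi fun _ : Fin n => Q).withDensity fun x => ∏ i, P.rnDeriv Q (x i) := by
  refine Measure.pi_eq fun s hs => ?_
  rw [withDensity_apply _ (MeasurableSet.univ_pi hs),
    ← lintegral_indicator (MeasurableSet.univ_pi hs)]
  have h1 : ∀ x : Fin n → X, (Set.univ.pi s).indicator (fun x => ∏ i, P.rnDeriv Q (x i)) x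
      = ∏ i, (s i).indicator (P.rnDeriv Q) (x i) := by
    intro x
    by_cases hx : x ∈ Set.univ.pi s
    · rw [Set.indicator_of_mem hx]
      refine Finset.prod_congr rfl fun i _ => ?_
      rw [Set.indicator_of_mem (hx i (Set.mem_univ i))]
    · rw [Set.indicator_of_notMem hx]
      obtain ⟨i, hi⟩ : ∃ i, x i ∉ s i := by simpa [Set.mem_pi] using hx
      exact (Finset.prod_eq_zero (Finset.mem_univ i) (Set.indicator_of_notMem hi _)).symm
  simp_rw [h1]
  rw [lintegral_pi_prod Q fun i => (Measure.measurable_rnDeriv P Q).indicator (hs i)]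
  refine Finset.prod_congr rfl fun i _ => ?_
  rw [lintegral_indicator (hs i), ← withDensity_apply _ (hs i),
    Measure.withDensity_rnDeriv_eq _ _ hPQ]

/-- Change of measure on a set where the log-likelihood ratio is controlled. -/
lemma pi_le_exp_mul_pi (P Q : Measure X) [IsProbabilityMeasure P]
    [IsProbabilityMeasure Q] (hPQ : P ≪ Q) {n : ℕ} {C : ℝ} {s : Set (Fin n → X)}
    (hs : MeasurableSet s) (hC : ∀ x ∈ s, ∑ i, llr P Q (x i) ≤ C) :
    Measure.pi (fun _ => P) s ≤ ENNReal.ofReal (Real.exp C) * Measure.pi (fun _ => Q) s := by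
  rw [pi_eq_withDensity_prod_rnDeriv P Q hPQ, withDensity_apply _ hs, ← setLIntegral_const]
  refine lintegral_mono_ae ?_
  rw [ae_restrict_iff' hs]
  have hfin : ∀ᵐ x ∂Measure.pi (fun _ : Fin n => Q), ∀ i, P.rnDeriv Q (x i) < ∞ :=
    ae_all_iff.2 fun i =>
      (measurePreserving_eval (fun _ : Fin n => Q) i).quasiMeasurePreserving.ae
        (Measure.rnDeriv_lt_top P Q)
  filter_upwards [hfin] with x hx hxs
  have h1 : ∀ i, P.rnDeriv Q (x i) ≤ ENNReal.ofReal (Real.exp (llr P Q (x i))) := by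
    intro i
    by_cases h0 : P.rnDeriv Q (x i) = 0
    · simp [h0]
    · rw [llr, Real.exp_log (ENNReal.toReal_pos h0 (hx i).ne), ENNReal.ofReal_toReal (hx i).ne]
  calc ∏ i, P.rnDeriv Q (x i) ≤ ∏ i, ENNReal.ofReal (Real.exp (llr P Q (x i))) :=
        Finset.prod_le_prod' fun i _ => h1 i
    _ = ENNReal.ofReal (Real.exp (∑ i, llr P Q (x i))) := by
        rw [Real.exp_sum, ENNReal.ofReal_prod_of_nonneg fun i _ => (Real.exp_pos _).le]
    _ ≤ _ := ENNReal.ofReal_le_ofReal (Real.exp_le_exp.2 (hC x hxs))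

/-- Chernoff's bound for i.i.d. sums. -/
lemma pi_sum_ge_le (Q : Measure X) [IsProbabilityMeasure Q] {g : X → ℝ} (hg : Measurable g)
    (hint : Integrable (fun x => Real.exp (g x)) Q) (n : ℕ) (a : ℝ) :
    Measure.pi (fun _ : Fin n => Q) {x | n * a ≤ ∑ i, g (x i)}
      ≤ ENNReal.ofReal (Real.exp (-(n * (a - Real.log (∫ x, Real.exp (g x) ∂Q))))) := by
  have hpos : 0 < ∫ x, Real.exp (g x) ∂Q := integral_exp_pos hint
  have hG : Measurable fun y => ENNReal.ofReal (Real.exp (g y)) := by fun_prop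
  have h1 : ∫⁻ x, ∏ i, ENNReal.ofReal (Real.exp (g (x i))) ∂Measure.pi (fun _ : Fin n => Q)
      = ENNReal.ofReal ((∫ x, Real.exp (g x) ∂Q) ^ n) := by
    rw [lintegral_pi_prod Q (f := fun _ y => ENNReal.ofReal (Real.exp (g y))) fun i => hG]
    rw [← ofReal_integral_eq_lintegral_ofReal hint
      (Eventually.of_forall fun x => (Real.exp_pos _).le)]
    simp [ENNReal.ofReal_pow hpos.le]
  have h2 : {x : Fin n → X | n * a ≤ ∑ i, g (x i)} ⊆ {x | ENNReal.ofReal (Real.exp (n * a))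
      ≤ ∏ i, ENNReal.ofReal (Real.exp (g (x i)))} := by
    intro x hx
    rw [Set.mem_ofPred_eq] at hx ⊢
    rw [← ENNReal.ofReal_prod_of_nonneg fun i _ => (Real.exp_pos _).le, ← Real.exp_sum]
    exact ENNReal.ofReal_le_ofReal (Real.exp_le_exp.2 hx)
  have hm : Measurable fun x : Fin n → X => ∏ i, ENNReal.ofReal (Real.exp (g (x i))) :=
    Finset.measurable_prod _ fun i _ => hG.comp (measurable_pi_apply i)
  refine (measure_mono h2).trans ((meas_ge_le_lintegral_div hm.aemeasurable
    (by simpa using Real.exp_pos _) ENNReal.ofReal_ne_top).trans ?_)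
  rw [h1, ← ENNReal.ofReal_div_of_pos (Real.exp_pos _)]
  refine ENNReal.ofReal_le_ofReal (le_of_eq ?_)
  rw [← Real.exp_log (pow_pos hpos n), ← Real.exp_sub, Real.log_pow]
  ring_nf

open ProbabilityTheory in
/-- The weak law of large numbers on finite product spaces. -/
lemma tendsto_pi_sum_gt (P : Measure X) [IsProbabilityMeasure P] {f : X → ℝ} (hf : Measurable f)
    (hint : Integrable f P) {ε : ℝ} (hε : 0 < ε) :
    Tendsto (fun n : ℕ => Measure.pi (fun _ : Fin n => P)
      {x | n * (∫ y, f y ∂P + ε) < ∑ i, f (x i)}) atTop (𝓝 0) := by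
  set μ := Measure.infinitePi fun _ : ℕ => P with hμ
  have hmp : ∀ i : ℕ, MeasurePreserving (fun ω : ℕ → X => ω i) μ P := fun i =>
    measurePreserving_eval_infinitePi (fun _ : ℕ => P) i
  have hind : iIndepFun (fun (i : ℕ) (ω : ℕ → X) => ω i) μ :=
    iIndepFun_infinitePi (X := fun _ => id) fun _ => measurable_id
  have hindf : iIndepFun (fun (i : ℕ) (ω : ℕ → X) => f (ω i)) μ :=
    iIndepFun_infinitePi (X := fun _ => f) fun _ => hf
  have hfl : ∀ i, μ.map (fun ω => f (ω i)) = P.map f := fun i => by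
    conv_rhs => rw [← (hmp i).map_eq, Measure.map_map hf (hmp i).measurable]
    rfl
  have hlaw := strong_law_ae_real (μ := μ) (fun (i : ℕ) ω => f (ω i))
    ((hmp 0).integrable_comp_of_integrable hint) (fun i j hij => hindf.indepFun hij)
    (fun i => ⟨(hf.comp (hmp i).measurable).aemeasurable, (hf.comp (hmp 0).measurable).aemeasurable,
      (hfl i).trans (hfl 0).symm⟩)
  have hmean : ∫ ω, f (ω 0) ∂μ = ∫ y, f y ∂P := by
    conv_rhs => rw [← (hmp 0).map_eq]
    rw [integral_map (hmp 0).aemeasurable hf.aestronglyMeasurable]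
  rw [hmean] at hlaw
  have hconv := tendstoInMeasure_of_tendsto_ae
    (f := fun (n : ℕ) (ω : ℕ → X) => (∑ i ∈ Finset.range n, f (ω i)) / n)
    (g := fun _ => ∫ y, f y ∂P) (fun n => by
      have : Measurable fun ω : ℕ → X => (∑ i ∈ Finset.range n, f (ω i)) / n := by fun_prop
      exact this.aestronglyMeasurable) hlaw
  rw [tendstoInMeasure_iff_norm] at hconv
  refine tendsto_of_tendsto_of_tendsto_of_le_of_le' tendsto_const_nhds (hconv ε hε)
    (Eventually.of_forall fun n => zero_le) ?_
  filter_upwards [eventually_gt_atTop 0] with n hn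
  have hn' : (0 : ℝ) < n := by exact_mod_cast hn
  have hrm : Measurable fun (ω : ℕ → X) (i : Fin n) => ω i := by fun_prop
  have hmap : μ.map (fun (ω : ℕ → X) (i : Fin n) => ω i) = Measure.pi fun _ => P := by
    have h := (iIndepFun_iff_map_fun_eq_pi_map
      (fun i : Fin n => (hmp i).aemeasurable)).1 (hind.precomp Fin.val_injective)
    refine h.trans ?_
    congr with i
    rw [(hmp i).map_eq]
  have hms : MeasurableSet {x : Fin n → X | n * (∫ y, f y ∂P + ε) < ∑ i, f (x i)} :=
    measurableSet_lt measurable_const (by fun_prop)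
  rw [← hmap, Measure.map_apply hrm hms]
  refine measure_mono fun ω hω => ?_
  simp only [Set.mem_preimage, Set.mem_ofPred_eq] at hω ⊢
  rw [Finset.sum_range]
  refine le_trans ?_ (le_abs_self _)
  rw [le_sub_iff_add_le, le_div_iff₀ hn']
  linarith

end Product

/-- One half of the Donsker-Varadhan variational formula: the relative entropy is approached by
bounded continuous test functions. -/
lemma exists_boundedContinuous_lt_integral_sub_log {X : Type*} [MeasurableSpace X]
    [TopologicalSpace X] [PolishSpace X] [BorelSpace X] (P Q : Measure X)
    [IsProbabilityMeasure P] [IsProbabilityMeasure Q] (hPQ : P ≪ Q)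
    (hint : Integrable (llr P Q) P) {η : ℝ} (hη : 0 < η) :
    ∃ g : BoundedContinuousFunction X ℝ,
      ∫ x, llr P Q x ∂P - η < ∫ x, g x ∂P - Real.log (∫ x, Real.exp (g x) ∂Q) := by
  let := TopologicalSpace.upgradeIsCompletelyMetrizable X
  set r : X → ℝ := fun x => (P.rnDeriv Q x).toReal with hr
  have hr0 : ∀ x, 0 ≤ r x := fun x => ENNReal.toReal_nonneg
  have hrm : Measurable r := (Measure.measurable_rnDeriv P Q).ennreal_toReal
  have hrpos : ∀ᵐ x ∂P, 0 < r x := by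
    filter_upwards [Measure.rnDeriv_pos hPQ, hPQ (Measure.rnDeriv_lt_top P Q)] with x h1 h2
    exact ENNReal.toReal_pos h1.ne' h2.ne
  have hrint : ∫ x, r x ∂Q = 1 := by
    rw [hr, Measure.integral_toReal_rnDeriv hPQ, probReal_univ]
  have hri : Integrable r Q := Measure.integrable_toReal_rnDeriv
  set f : ℕ → X → ℝ := fun m x =>
    if r x = 0 then -(m : ℝ) else max (-(m : ℝ)) (min (Real.log (r x)) m) with hf
  have hfm : ∀ m, Measurable (f m) := fun m =>
    Measurable.ite (hrm (measurableSet_singleton 0)) measurable_const (by fun_prop)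
  have hfb : ∀ m x, |f m x| ≤ m := by
    intro m x
    have hm : (0 : ℝ) ≤ m := m.cast_nonneg
    rw [hf, abs_le]
    dsimp only
    split_ifs
    · exact ⟨le_rfl, by linarith⟩
    · exact ⟨le_max_left _ _, max_le (by linarith) (min_le_right _ _)⟩
  have hfexp : ∀ m x, Real.exp (f m x) ≤ r x + Real.exp (-(m : ℝ)) := by
    intro m x
    simp only [hf]
    split_ifs with h0
    · linarith [hr0 x]
    · have hrx : 0 < r x := lt_of_le_of_ne (hr0 x) (Ne.symm h0)
      rcases max_choice (-(m : ℝ)) (min (Real.log (r x)) m) with h | h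
      · rw [h]
        linarith
      · rw [h]
        have := Real.exp_le_exp.2 (min_le_left (Real.log (r x)) m)
        rw [Real.exp_log hrx] at this
        linarith [Real.exp_pos (-(m : ℝ))]
  have hlim : Tendsto (fun m => ∫ x, f m x ∂P) atTop (𝓝 (∫ x, llr P Q x ∂P)) := by
    refine tendsto_integral_of_dominated_convergence (fun x => |llr P Q x|)
      (fun m => (hfm m).aestronglyMeasurable) hint.abs (fun m => ?_) ?_
    · filter_upwards [hrpos] with x hx
      have hm : (0 : ℝ) ≤ m := m.cast_nonneg
      rw [hf, Real.norm_eq_abs]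
      simp only [hx.ne', if_false]
      change |max (-(m : ℝ)) (min (Real.log (r x)) m)| ≤ |Real.log (r x)|
      have h1 := neg_abs_le (Real.log (r x))
      have h2 := le_abs_self (Real.log (r x))
      have h3 := abs_nonneg (Real.log (r x))
      rw [abs_le]
      refine ⟨?_, max_le (by linarith) ((min_le_left _ _).trans h2)⟩
      exact le_max_of_le_right (le_min h1 (by linarith))
    · filter_upwards [hrpos] with x hx
      refine tendsto_const_nhds.congr' ?_
      filter_upwards [eventually_ge_atTop ⌈|Real.log (r x)|⌉₊] with m hm
      have hm' : |Real.log (r x)| ≤ m := Nat.ceil_le.1 hm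
      rw [abs_le] at hm'
      simp only [hf, hx.ne', if_false]
      rw [min_eq_left hm'.2, max_eq_right hm'.1]
      rfl
  set δ := η / 5 with hδ
  have hδ0 : 0 < δ := by positivity
  have hexp0 : Tendsto (fun m : ℕ => Real.exp (-(m : ℝ))) atTop (𝓝 0) :=
    Real.tendsto_exp_neg_atTop_nhds_zero.comp tendsto_natCast_atTop_atTop
  obtain ⟨m, hm1, hm2⟩ := ((hlim.eventually_const_lt (sub_lt_self _ hδ0)).and
    (hexp0.eventually_lt_const hδ0)).exists
  have hmi : ∀ R : Measure X, IsFiniteMeasure R → Integrable (f m) R := fun R _ =>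
    integrable_of_abs_le R (hfm m) (hfb m)
  obtain ⟨g₀, hg₀, hg₀i⟩ := (hmi (P + Q) inferInstance).exists_boundedContinuous_integral_sub_le
    (ε := δ * Real.exp (-(m : ℝ))) (by positivity)
  have hgc : Continuous fun x => max (-(m : ℝ)) (min (g₀ x) m) := by fun_prop
  have hgb : ∀ x, |max (-(m : ℝ)) (min (g₀ x) m)| ≤ m := fun x => by
    have hm : (0 : ℝ) ≤ m := m.cast_nonneg
    exact abs_le.2 ⟨le_max_left _ _, max_le (by linarith) (min_le_right _ _)⟩
  set g : BoundedContinuousFunction X ℝ :=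
    BoundedContinuousFunction.ofNormedAddCommGroup _ hgc m hgb with hg
  have hgx : ∀ x, g x = max (-(m : ℝ)) (min (g₀ x) m) := fun x => rfl
  have hgm : Measurable g := g.continuous.measurable
  have hclose : ∀ x, |f m x - g x| ≤ ‖f m x - g₀ x‖ := by
    intro x
    have hfx : f m x = max (-(m : ℝ)) (min (f m x) m) := by
      have := abs_le.1 (hfb m x)
      rw [min_eq_left this.2, max_eq_right this.1]
    rw [hgx]
    conv_lhs => rw [hfx]
    refine (abs_max_sub_max_le_max _ _ _ _).trans (max_le (by simp) ?_)
    exact (abs_min_sub_min_le_max _ _ _ _).trans (max_le le_rfl (by simp))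
  have hdi : ∀ R : Measure X, IsFiniteMeasure R → Integrable (fun x => |f m x - g x|) R :=
    fun R _ => ((hmi R inferInstance).sub (integrable_of_abs_le R hgm hgb)).abs
  have hL1 : ∫ x, |f m x - g x| ∂P + ∫ x, |f m x - g x| ∂Q ≤ δ * Real.exp (-(m : ℝ)) := by
    rw [← integral_add_measure (hdi P inferInstance) (hdi Q inferInstance)]
    exact (integral_mono (hdi _ inferInstance)
      ((hmi _ inferInstance).sub hg₀i).norm hclose).trans hg₀
  have hP0 : 0 ≤ ∫ x, |f m x - g x| ∂P := integral_nonneg fun x => abs_nonneg _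
  have hQ0 : 0 ≤ ∫ x, |f m x - g x| ∂Q := integral_nonneg fun x => abs_nonneg _
  have hem1 : Real.exp (-(m : ℝ)) ≤ 1 := Real.exp_le_one_iff.2 (by simp)
  have hgP : ∫ x, f m x ∂P - δ ≤ ∫ x, g x ∂P := by
    have h1 : ∫ x, (f m x - g x) ∂P ≤ ∫ x, |f m x - g x| ∂P :=
      integral_mono ((hmi P inferInstance).sub (integrable_of_abs_le P hgm hgb))
        (hdi P inferInstance) fun x => le_abs_self _
    rw [integral_sub (hmi P inferInstance) (integrable_of_abs_le P hgm hgb)] at h1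
    nlinarith
  have hgexp : ∀ x, Real.exp (g x)
      ≤ r x + Real.exp (-(m : ℝ)) + Real.exp m * |f m x - g x| := by
    intro x
    have h1 : Real.exp (g x) - Real.exp (f m x) ≤ Real.exp (g x) * (g x - f m x) := by
      have := Real.add_one_le_exp (f m x - g x)
      have h2 : Real.exp (f m x) = Real.exp (g x) * Real.exp (f m x - g x) := by
        rw [← Real.exp_add]
        ring_nf
      rw [h2]
      nlinarith [Real.exp_pos (g x)]
    have h3 : Real.exp (g x) * (g x - f m x) ≤ Real.exp m * |f m x - g x| := by
      calc _ ≤ Real.exp (g x) * |f m x - g x| := by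
            gcongr
            rw [abs_sub_comm]
            exact le_abs_self _
        _ ≤ _ := by
            gcongr
            exact (le_abs_self _).trans (hgb x)
    linarith [hfexp m x]
  have hgei : Integrable (fun x => Real.exp (g x)) Q := by
    have := integrable_exp_mul_sub_of_abs_le Q hgm hgb 1 0
    simpa using this
  have hgQ : ∫ x, Real.exp (g x) ∂Q ≤ 1 + 2 * δ := by
    have h1 := integral_mono hgei ((hri.add (integrable_const (Real.exp (-(m : ℝ))))).add
      ((hdi Q inferInstance).const_mul (Real.exp m))) hgexp
    have h2 : ∫ x, (r x + Real.exp (-(m : ℝ)) + Real.exp m * |f m x - g x|) ∂Q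
        = 1 + Real.exp (-(m : ℝ)) + Real.exp m * ∫ x, |f m x - g x| ∂Q := by
      rw [integral_add (f := fun x => r x + Real.exp (-(m : ℝ)))
        (hri.add (integrable_const _)) ((hdi Q inferInstance).const_mul _),
        integral_add hri (integrable_const _), integral_const_mul, hrint]
      simp
    have h3 : Real.exp m * ∫ x, |f m x - g x| ∂Q ≤ δ := by
      calc _ ≤ Real.exp m * (δ * Real.exp (-(m : ℝ))) := by
            gcongr
            linarith
        _ = δ * (Real.exp m * Real.exp (-(m : ℝ))) := by ring
        _ = δ := by rw [← Real.exp_add]; simp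
    have h4 := h1.trans_eq h2
    linarith
  have hlog : Real.log (∫ x, Real.exp (g x) ∂Q) ≤ 2 * δ := by
    have := Real.log_le_sub_one_of_pos (integral_exp_pos hgei)
    linarith
  refine ⟨g, ?_⟩
  linarith

/-- The type-II error exponent of the MMD test is at most the relative entropy. -/
lemma eventually_expRate_mmd_le {X : Type*} [MeasurableSpace X] [Nonempty X] {k : X → X → ℝ}
    {K : ℝ} (hk : Measurable (Function.uncurry k)) (hk_symm : ∀ x y, k x y = k y x)
    (hK : 0 < K) (hk_bdd : ∀ x y, k x y ∈ Set.Icc (0 : ℝ) K)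
    (h_sep : ∀ R S : ProbabilityMeasure X,
      mmd k (R : Measure X) (S : Measure X) = 0 ↔ R = S)
    (h_tri : ∀ R S T : ProbabilityMeasure X,
      mmd k (R : Measure X) (T : Measure X)
        ≤ mmd k (R : Measure X) (S : Measure X) + mmd k (S : Measure X) (T : Measure X))
    (P Q : ProbabilityMeasure X) {α : ℝ} (hα0 : 0 < α) (hα1 : α < 1)
    (hPQ : (P : Measure X) ≪ Q) (hint : Integrable (llr (P : Measure X) Q) P) {z : ℝ}
    (hz : ∫ x, llr (P : Measure X) Q x ∂(P : Measure X) < z) :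
    ∀ᶠ n : ℕ in atTop, expRate n (Measure.pi (fun _ : Fin n => (Q : Measure X))
      {x | mmd k (P : Measure X) (empMeas n x : Measure X)
        ≤ Real.sqrt (2 * K / n) * (1 + Real.sqrt (Real.log (1 / α)))}) ≤ (z : EReal) := by
  set D := ∫ x, llr (P : Measure X) Q x ∂(P : Measure X) with hD
  set ε := (z - D) / 2 with hε
  have hε0 : 0 < ε := by
    rw [hε]
    linarith
  set β := (1 - α) / 2 with hβ
  have hβ0 : 0 < β := by
    rw [hβ]
    linarith
  have hwl := tendsto_pi_sum_gt (P : Measure X) (measurable_llr (P : Measure X) Q) hint hε0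
  have hexp : Tendsto (fun n : ℕ => Real.exp (-(ε * n))) atTop (𝓝 0) :=
    Real.tendsto_exp_neg_atTop_nhds_zero.comp
      (tendsto_natCast_atTop_atTop.const_mul_atTop hε0)
  filter_upwards [eventually_gt_atTop 0, hexp.eventually_lt_const hβ0,
    hwl.eventually_lt_const (ENNReal.ofReal_pos.2 hβ0)] with n hn hn1 hn2
  set τ := Real.sqrt (2 * K / n) * (1 + Real.sqrt (Real.log (1 / α))) with hτ
  set A := {x : Fin n → X | mmd k (P : Measure X) (empMeas n x : Measure X) ≤ τ} with hA
  set B := {x : Fin n → X | n * (D + ε) < ∑ i, llr (P : Measure X) Q (x i)} with hB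
  have hAm : MeasurableSet A :=
    measurableSet_le (measurable_mmdSq_empMeas hk hk_bdd _ hn).sqrt measurable_const
  have hBm : MeasurableSet B :=
    measurableSet_lt measurable_const (Finset.measurable_sum _ fun i _ =>
      (measurable_llr (P : Measure X) Q).comp (measurable_pi_apply i))
  have h1 : Measure.pi (fun _ => (P : Measure X)) Aᶜ ≤ ENNReal.ofReal α := by
    have := measure_lt_mmd_empMeas_le hk hk_symm hK hk_bdd h_sep h_tri P hα0 hα1 hn
    refine le_trans (measure_mono ?_) this
    intro x hx
    change τ < mmd k (P : Measure X) (empMeas n x : Measure X)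
    exact lt_of_not_ge fun hle => hx hle
  have h2 : (1 : ℝ≥0∞) ≤ Measure.pi (fun _ => (P : Measure X)) (A \ B)
      + (ENNReal.ofReal α + ENNReal.ofReal β) := by
    calc (1 : ℝ≥0∞) = Measure.pi (fun _ : Fin n => (P : Measure X)) Set.univ :=
          measure_univ.symm
      _ ≤ Measure.pi (fun _ => (P : Measure X)) ((A \ B) ∪ (Aᶜ ∪ B)) :=
          measure_mono fun x _ => by
            by_cases hxA : x ∈ A <;> by_cases hxB : x ∈ B <;> simp [hxA, hxB]
      _ ≤ _ := (measure_union_le _ _).trans (by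
          gcongr
          refine (measure_union_le _ _).trans ?_
          gcongr)
  have h3 : ENNReal.ofReal β ≤ Measure.pi (fun _ => (P : Measure X)) (A \ B) := by
    rw [← ENNReal.ofReal_add hα0.le hβ0.le] at h2
    have h4 : ENNReal.ofReal β = 1 - ENNReal.ofReal (α + β) := by
      rw [← ENNReal.ofReal_one, ← ENNReal.ofReal_sub _ (by positivity)]
      congr 1
      rw [hβ]
      ring
    rw [h4]
    exact tsub_le_iff_right.2 h2
  have h5 := pi_le_exp_mul_pi (P : Measure X) Q hPQ (C := n * (D + ε)) (hAm.diff hBm)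
    fun x hx => not_lt.1 hx.2
  have h6 : ENNReal.ofReal (Real.exp (-(n * (D + ε)))) * ENNReal.ofReal β
      ≤ Measure.pi (fun _ => (Q : Measure X)) A := by
    calc _ ≤ ENNReal.ofReal (Real.exp (-(n * (D + ε)))) * (ENNReal.ofReal (Real.exp (n * (D + ε)))
          * Measure.pi (fun _ => (Q : Measure X)) (A \ B)) := by
          gcongr
          exact h3.trans h5
      _ = Measure.pi (fun _ => (Q : Measure X)) (A \ B) := by
          rw [← mul_assoc, ← ENNReal.ofReal_mul (Real.exp_pos _).le, ← Real.exp_add]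
          simp
      _ ≤ _ := measure_mono Set.sdiff_subset
  refine expRate_le hn (le_trans ?_ h6)
  rw [← ENNReal.ofReal_mul (Real.exp_pos _).le]
  refine ENNReal.ofReal_le_ofReal ?_
  calc Real.exp (-(n * z)) = Real.exp (-(n * (D + ε))) * Real.exp (-(ε * n)) := by
        rw [← Real.exp_add, hε]
        ring_nf
    _ ≤ _ := by gcongr

/-- The type-II error exponent of the MMD test is at least the relative entropy, for any
thresholds tending to zero. -/
lemma eventually_le_expRate_mmd {X : Type*} [MeasurableSpace X] [TopologicalSpace X]
    [PolishSpace X] [BorelSpace X] [Nonempty X] {k : X → X → ℝ} {K : ℝ}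
    (hk : Measurable (Function.uncurry k)) (hk_symm : ∀ x y, k x y = k y x)
    (hk_bdd : ∀ x y, k x y ∈ Set.Icc (0 : ℝ) K)
    (h_nhds : ∀ s : Set (ProbabilityMeasure X), IsOpen s → ∀ R ∈ s, ∃ ε > 0,
      ∀ S : ProbabilityMeasure X, mmd k (S : Measure X) (R : Measure X) < ε → S ∈ s)
    (P Q : ProbabilityMeasure X) {γ : ℕ → ℝ} (hγ : Tendsto γ atTop (𝓝 0))
    (hPQ : (P : Measure X) ≪ Q) (hint : Integrable (llr (P : Measure X) Q) P) {z : ℝ}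
    (hz : z < ∫ x, llr (P : Measure X) Q x ∂(P : Measure X)) :
    ∀ᶠ n : ℕ in atTop, (z : EReal) ≤ expRate n (Measure.pi (fun _ : Fin n => (Q : Measure X))
      {x | mmd k (P : Measure X) (empMeas n x : Measure X) ≤ γ n}) := by
  set D := ∫ x, llr (P : Measure X) Q x ∂(P : Measure X) with hD
  set η := (D - z) / 2 with hη
  have hη0 : 0 < η := by
    rw [hη]
    linarith
  obtain ⟨g, hg⟩ := exists_boundedContinuous_lt_integral_sub_log (P : Measure X) Q hPQ hint hη0
  set a := ∫ x, g x ∂(P : Measure X) - η with ha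
  have hU : IsOpen {R : ProbabilityMeasure X | a < ∫ x, g x ∂(R : Measure X)} :=
    isOpen_lt continuous_const
      (ProbabilityMeasure.continuous_integral_boundedContinuousFunction g)
  obtain ⟨ε, hε0, hε⟩ := h_nhds _ hU P (by
    rw [Set.mem_ofPred_eq, ha]
    linarith)
  filter_upwards [eventually_gt_atTop 0, hγ.eventually_lt_const hε0] with n hn hnγ
  have hn' : (0 : ℝ) < n := by exact_mod_cast hn
  have hgm : Measurable g := g.continuous.measurable
  have hgi : Integrable (fun x => Real.exp (g x)) (Q : Measure X) := by
    have := integrable_exp_mul_sub_of_abs_le (Q : Measure X) hgm g.norm_coe_le_norm 1 0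
    simpa using this
  refine le_expRate hn ((measure_mono fun x hx => ?_).trans
    ((pi_sum_ge_le (Q : Measure X) hgm hgi n a).trans ?_))
  · have hx' := hε (empMeas n x) (by
      rw [mmd_comm hk hk_symm hk_bdd]
      exact lt_of_le_of_lt hx hnγ)
    rw [Set.mem_ofPred_eq, integral_empMeas hn x hgm] at hx'
    rw [Set.mem_ofPred_eq]
    have h := mul_le_mul_of_nonneg_left hx'.le hn'.le
    rwa [mul_inv_cancel_left₀ hn'.ne'] at h
  · refine ENNReal.ofReal_le_ofReal (Real.exp_le_exp.2 ?_)
    rw [neg_le_neg_iff]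
    gcongr
    linarith

/-- The simple MMD kernel test `d_k(P, Q̂_n) ≤ γ_n` with
`γ_n = sqrt(2K/n)(1 + sqrt(log(1/α)))` is a level-`α` test that is universally optimal:
under `H₀ : Q = P` its type-I error probability is at most `α` for every `n ≥ 1`, and under
`H₁` with `0 < D(P‖Q) < ∞` its type-II error exponent equals `D(P‖Q)`. -/
theorem mmd_simple_test_optimal {X : Type*} [MeasurableSpace X] [TopologicalSpace X]
    [PolishSpace X] [LocallyCompactSpace X] [T2Space X] [BorelSpace X] [Nonempty X]
    (k : X → X → ℝ) (hk_cont : Continuous fun p : X × X => k p.1 p.2)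
    (hk_symm : ∀ x y, k x y = k y x)
    (hk_psd : ∀ (N : ℕ) (z : Fin N → X) (c : Fin N → ℝ),
      0 ≤ ∑ i, ∑ j, c i * c j * k (z i) (z j))
    (K : ℝ) (hK : 0 < K) (hk_bdd : ∀ x y, k x y ∈ Set.Icc (0 : ℝ) K)
    (h_sep : ∀ R S : ProbabilityMeasure X,
      mmd k (R : Measure X) (S : Measure X) = 0 ↔ R = S)
    (h_tri : ∀ R S T : ProbabilityMeasure X,
      mmd k (R : Measure X) (T : Measure X)
        ≤ mmd k (R : Measure X) (S : Measure X) + mmd k (S : Measure X) (T : Measure X))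
    (h_metrize : ∀ s : Set (ProbabilityMeasure X),
      IsOpen s ↔ ∀ R ∈ s, ∃ ε > 0,
        ∀ S : ProbabilityMeasure X, mmd k (S : Measure X) (R : Measure X) < ε → S ∈ s)
    (P Q : ProbabilityMeasure X) {α : ℝ} (hα0 : 0 < α) (hα1 : α < 1)
    (γ : ℕ → ℝ)
    (hγ : ∀ n : ℕ, γ n = Real.sqrt (2 * K / n) * (1 + Real.sqrt (Real.log (1 / α)))) :
    (Q = P → ∀ n : ℕ, 0 < n →
      Measure.pi (fun _ : Fin n => (P : Measure X))
          {x | γ n < mmd k (P : Measure X) (empMeas n x : Measure X)}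
        ≤ ENNReal.ofReal α)
    ∧ (0 < klDiv (P : Measure X) (Q : Measure X) →
        klDiv (P : Measure X) (Q : Measure X) < ⊤ →
        liminf (fun n : ℕ => expRate n
            (Measure.pi (fun _ : Fin n => (Q : Measure X))
              {x | mmd k (P : Measure X) (empMeas n x : Measure X) ≤ γ n})) atTop
          = ((klDiv (P : Measure X) (Q : Measure X) : ℝ≥0∞) : EReal)) := by
  have hk : Measurable (Function.uncurry k) := hk_cont.measurable
  obtain rfl : γ = fun n : ℕ =>
      Real.sqrt (2 * K / n) * (1 + Real.sqrt (Real.log (1 / α))) := funext hγ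
  refine ⟨fun _ n hn =>
    measure_lt_mmd_empMeas_le hk hk_symm hK hk_bdd h_sep h_tri P hα0 hα1 hn, fun hpos hfin => ?_⟩
  have hac : (P : Measure X) ≪ Q ∧ Integrable (llr (P : Measure X) Q) P := by
    by_contra h
    rw [klDiv, if_neg h] at hfin
    exact lt_irrefl _ hfin
  rw [klDiv, if_pos hac] at hpos ⊢
  obtain ⟨hPQ, hint⟩ := hac
  rw [EReal.coe_ennreal_ofReal, max_eq_left (ENNReal.ofReal_pos.1 hpos).le]
  have hγ0 : Tendsto (fun n : ℕ => Real.sqrt (2 * K / n) * (1 + Real.sqrt (Real.log (1 / α))))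
      atTop (𝓝 0) := by
    have h := ((tendsto_const_div_atTop_nhds_zero_nat (2 * K)).sqrt).mul_const
      (1 + Real.sqrt (Real.log (1 / α)))
    simpa using h
  refine le_antisymm (EReal.le_of_forall_lt_iff_le.1 fun z hz => ?_)
    (EReal.ge_of_forall_gt_iff_ge.1 fun z hz => ?_)
  · exact liminf_le_of_frequently_le' (eventually_expRate_mmd_le hk hk_symm hK hk_bdd h_sep h_tri
      P Q hα0 hα1 hPQ hint (EReal.coe_lt_coe_iff.1 hz)).frequently
  · exact le_liminf_of_le (by isBoundedDefault) (eventually_le_expRate_mmd hk hk_symm hk_bdd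
      (fun s hs => (h_metrize s).1 hs) P Q hγ0 hPQ hint (EReal.coe_lt_coe_iff.1 hz))
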